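/- arXiv:2210.02835 — 5 statements merged into one kernel-verified Lean document; each statement's English description precedes it below -/
import Mathlib

section
/- Let f be an injective coloring of a finite simple graph G. If a walk W = ⟨w₁, …, w_p⟩ in G transforms f into f itself, then the number of distinct vertices occurring in W is at most (p + 1)/2. -/
/-- Swap the colors of vertices `a` and `b`. -/
def swapC {V C : Type*} [DecidableEq V] (f : V → C) (a b : V) : V → C :=
  fun v => if v = a then f b else if v = b then f a else f v

/-- The coloring obtained from `f` by sequentially swapping the colors of
consecutive vertices along the list (walk) of vertices. -/
def transformList {V C : Type*} [DecidableEq V] : List V → (V → C) → (V → C)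
  | [], f => f
  | [_], f => f
  | a :: b :: rest, f => transformList (b :: rest) (swapC f a b)

theorem swapC_of_ne {V C : Type*} [DecidableEq V] (f : V → C) {a b v : V}
    (ha : v ≠ a) (hb : v ≠ b) : swapC f a b v = f v := by
  simp [swapC, ha, hb]

theorem swapC_injective {V C : Type*} [DecidableEq V] {f : V → C} (hf : Function.Injective f)
    (a b : V) : Function.Injective (swapC f a b) := by
  have h : swapC f a b = f ∘ Equiv.swap a b := by
    funext v
    simp only [swapC, Function.comp_apply, Equiv.swap_apply_def]
    split_ifs <;> rfl
  rw [h]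
  exact hf.comp (Equiv.injective _)

theorem transformList_injective {V C : Type*} [DecidableEq V] :
    ∀ (l : List V) {f : V → C}, Function.Injective f → Function.Injective (transformList l f)
  | [], _, hf => hf
  | [_], _, hf => hf
  | a :: b :: rest, _, hf => transformList_injective (b :: rest) (swapC_injective hf a b)

theorem transformList_of_notMem {V C : Type*} [DecidableEq V] {v : V} :
    ∀ (l : List V) (f : V → C), v ∉ l → transformList l f v = f v
  | [], _, _ => rfl
  | [_], _, _ => rfl
  | a :: b :: rest, f, hv => by
    have h := transformList_of_notMem (b :: rest) (swapC f a b) (List.not_mem_of_not_mem_cons hv)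
    simp only [List.mem_cons, not_or] at hv
    exact h.trans (swapC_of_ne f hv.1 hv.2.1)

open Classical in
/-- Every visited vertex other than the start has its color moved at least once, and at least twice
if that color ends up where it began; each step of the walk moves only one such color. -/
theorem card_visited_add_card_fixed_lt_length {V C : Type*} [DecidableEq V] (G : SimpleGraph V) :
    ∀ (rest : List V) (a : V) (f : V → C), Function.Injective f →
      (a :: rest).IsChain G.Adj →
      ((a :: rest).toFinset.erase a).card +
        (((a :: rest).toFinset.erase a).filter
          fun v => transformList (a :: rest) f v = f v).card < (a :: rest).length
  | [], a, f, _, _ => by simp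
  | b :: rest, a, f, hf, hl => by
    rw [List.isChain_cons_cons] at hl
    have hab : a ≠ b := hl.1.ne
    have ih := card_visited_add_card_fixed_lt_length G rest b (swapC f a b)
      (swapC_injective hf a b) hl.2
    have hinj := transformList_injective (b :: rest) (swapC_injective hf a b)
    have hout := transformList_of_notMem (v := a) (b :: rest) (swapC f a b)
    have hT : (a :: b :: rest).toFinset.erase a = (b :: rest).toFinset.erase a := by
      rw [List.toFinset_cons, Finset.erase_insert_eq_erase]
    have hbS : b ∈ (b :: rest).toFinset := by simp
    have hlen : (a :: b :: rest).length = (b :: rest).length + 1 := rfl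
    rw [hT, hlen]
    change _ + (Finset.filter (fun v => transformList (b :: rest) (swapC f a b) v = f v) _).card < _
    rw [← List.mem_toFinset] at hout
    generalize transformList (b :: rest) (swapC f a b) = g at *
    generalize (b :: rest).toFinset = S at *
    have hb := Finset.card_erase_add_one hbS
    have hfixed : ∀ v ∈ (S.erase a).filter (fun v => g v = f v), v ≠ b →
        v ∈ (S.erase b).filter (fun v => g v = swapC f a b v) := by
      intro v hv hvb
      simp only [Finset.mem_filter, Finset.mem_erase] at hv ⊢
      exact ⟨⟨hvb, hv.1.2⟩, by rw [swapC_of_ne f hv.1.1 hvb, hv.2]⟩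
    by_cases haS : a ∈ S
    · have ha := Finset.card_erase_add_one haS
      have hle := (Finset.card_le_card (show (S.erase a).filter (fun v => g v = f v) ⊆
          insert b ((S.erase b).filter (fun v => g v = swapC f a b v)) from fun v hv =>
        Finset.mem_insert.2 (or_iff_not_imp_left.2 (hfixed v hv)))).trans
          (Finset.card_insert_le _ _)
      omega
    · have hle := Finset.card_le_card (show (S.erase a).filter (fun v => g v = f v) ⊆
          (S.erase b).filter (fun v => g v = swapC f a b v) from fun v hv => hfixed v hv (by
        rintro rfl
        refine hab (hinj ?_)
        rw [hout haS, (Finset.mem_filter.1 hv).2]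
        simp [swapC]))
      rw [Finset.erase_eq_of_notMem haS] at hle ⊢
      omega

/-- if an injective coloring `f` is transformed into itself by a
walk `⟨w₁, …, w_p⟩` in a finite simple graph, then the number of distinct
vertices occurring in the walk is at most `(p + 1) / 2`. -/
theorem injective_fixed_walk_few_vertices {V C : Type*} [Fintype V] [DecidableEq V]
    (G : SimpleGraph V) (f : V → C) (hf : Function.Injective f)
    (l : List V) (hl : l.Chain' G.Adj) (hne : l ≠ [])
    (htrans : transformList l f = f) :
    l.toFinset.card ≤ (l.length + 1) / 2 := by
  obtain ⟨a, rest, rfl⟩ := List.exists_cons_of_ne_nil hne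
  have h := card_visited_add_card_fixed_lt_length G rest a f hf hl
  rw [htrans] at h
  have ha := Finset.card_erase_add_one (show a ∈ (a :: rest).toFinset by simp)
  simp only [Finset.filter_true] at h
  omega
end

section
/- Under the stated complete-graph setup, there exists a walk W in K from s to t such that every vertex of P occurs in W, W transforms f into f′, and the length of W is at most |R| + cc − 2. -/
/-- Multiplying by a transposition of two points in different cycles coarsens the cycle
partition. -/
theorem sameCycle_mul_swap_of_not_sameCycle {V : Type*} [Finite V] [DecidableEq V]
    {σ : Equiv.Perm V} {u v : V} (h : ¬ σ.SameCycle u v) :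
    (σ * Equiv.swap u v).SameCycle u v ∧
      ∀ a b, σ.SameCycle a b → (σ * Equiv.swap u v).SameCycle a b := by
  set τ := σ * Equiv.swap u v with hτ
  have hτu : τ u = σ v := by simp [hτ]
  have hτv : τ v = σ u := by simp [hτ]
  have hτ_ne : ∀ x, x ≠ u → x ≠ v → τ x = σ x := fun x hu hv => by
    simp [hτ, Equiv.swap_apply_of_ne_of_ne hu hv]
  have self : ∀ x, τ.SameCycle x (τ x) := fun x => ⟨1, by simp⟩
  have orbit : ∀ k : ℕ, τ.SameCycle u ((σ ^ (k + 1)) v) := by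
    intro k
    induction k with
    | zero => simpa [hτu] using self u
    | succ k ih =>
      rw [pow_succ', Equiv.Perm.mul_apply]
      have hu : (σ ^ (k + 1)) v ≠ u := fun e => h (Equiv.Perm.SameCycle.symm ⟨(k + 1 : ℕ), by
        rw [zpow_natCast]; exact e⟩)
      by_cases hv : (σ ^ (k + 1)) v = v
      · rw [hv, ← hτu]; exact self u
      · rw [← hτ_ne _ hu hv]; exact ih.trans (self _)
  have huv : τ.SameCycle u v := by
    have := orbit (orderOf σ - 1)
    rwa [Nat.sub_add_cancel (orderOf_pos σ), pow_orderOf_eq_one] at this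
  have step : ∀ x, τ.SameCycle x (σ x) := by
    intro x
    by_cases hu : x = u
    · rw [hu, ← hτv]; exact huv.trans (self v)
    by_cases hv : x = v
    · rw [hv, ← hτu]; exact huv.symm.trans (self u)
    · rw [← hτ_ne x hu hv]; exact self x
  refine ⟨huv, fun a b hab => ?_⟩
  obtain ⟨k, -, -, rfl⟩ := hab.exists_pow_eq''
  induction k with
  | zero => simpa using Equiv.Perm.SameCycle.refl τ a
  | succ k ih =>
    rw [pow_succ', Equiv.Perm.mul_apply]
    exact (ih ⟨k, by simp⟩).trans (step _)

/-- Cutting a point `s` out of its cycle keeps all other points of that cycle together. -/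
theorem sameCycle_mul_swap_of_apply_eq {V : Type*} [Finite V] [DecidableEq V]
    {σ : Equiv.Perm V} {s v : V} (hv : σ v = s) {a b : V} (ha : a ≠ s) (hb : b ≠ s)
    (hab : σ.SameCycle a b) : (σ * Equiv.swap s v).SameCycle a b := by
  set τ := σ * Equiv.swap s v with hτ
  have hτs : τ s = s := by simp [hτ, hv]
  have hτv : τ v = σ s := by simp [hτ]
  have self : ∀ x, τ.SameCycle x (τ x) := fun x => ⟨1, by simp⟩
  have orbit : ∀ k : ℕ, ((σ ^ k) a ≠ s → τ.SameCycle a ((σ ^ k) a)) ∧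
      ((σ ^ k) a = s → τ.SameCycle a v) := by
    intro k
    induction k with
    | zero => exact ⟨fun _ => Equiv.Perm.SameCycle.refl τ a, fun e => absurd e ha⟩
    | succ k ih =>
      rw [pow_succ', Equiv.Perm.mul_apply]
      generalize (σ ^ k) a = x at ih
      by_cases hxs : x = s
      · subst hxs
        refine ⟨fun _ => ?_, fun _ => ih.2 rfl⟩
        rw [← hτv]
        exact (ih.2 rfl).trans (self v)
      by_cases hxv : x = v
      · subst hxv
        exact ⟨fun e => absurd hv e, fun _ => ih.1 hxs⟩
      · have hx : τ x = σ x := by simp [hτ, Equiv.swap_apply_of_ne_of_ne hxs hxv]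
        rw [← hx]
        exact ⟨fun _ => (ih.1 hxs).trans (self x),
          fun e => absurd (τ.injective (e.trans hτs.symm)) hxs⟩
  obtain ⟨k, -, -, rfl⟩ := hab.exists_pow_eq''
  exact (orbit k).1 hb

theorem swapC_eq_comp_swap {V C : Type*} [DecidableEq V] (f : V → C) (a b : V) :
    swapC f a b = f ∘ Equiv.swap a b := by
  funext v
  simp only [swapC, Function.comp_apply, Equiv.swap_apply_def]
  split_ifs <;> rfl

/-- A token at `s` can realize a permutation `σ` supported in `R` by a walk through `R` ending at
`σ s`, whose length is controlled by the number of labels of a labelling of `R` in which points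
with equal labels lie in a common cycle. -/
theorem exists_walk_of_perm {V C α : Type*} [Finite V] [DecidableEq V] [DecidableEq α] (n : ℕ) :
    ∀ (R : Finset V) (L : V → α) (σ : Equiv.Perm V) (f : V → C) (s : V),
      R.card + (R.image L).card ≤ n → s ∈ R → (∀ v, v ∉ R → σ v = v) →
      (∀ a ∈ R, ∀ b ∈ R, L a = L b → σ.SameCycle a b) →
      ∃ l : List V, (s :: l).IsChain (· ≠ ·) ∧ (s :: l).getLast? = some (σ s) ∧
        (∀ v ∈ R, v ∈ s :: l) ∧ (∀ v, transformList (s :: l) f (σ v) = f v) ∧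
        l.length + 2 ≤ R.card + (R.image L).card := by
  induction n with
  | zero =>
    intro R L σ f s hn hs
    have := Finset.card_pos.2 ⟨s, hs⟩
    omega
  | succ n ih =>
    intro R L σ f s hn hs hfix hL
    have extend : ∀ (w : V) (l : List V), s ≠ w → (w :: l).IsChain (· ≠ ·) →
        (w :: l).getLast? = some ((σ * Equiv.swap s w) w) →
        (∀ v, transformList (w :: l) (swapC f s w) ((σ * Equiv.swap s w) v) = swapC f s w v) →
        (s :: w :: l).IsChain (· ≠ ·) ∧ (s :: w :: l).getLast? = some (σ s) ∧
          ∀ v, transformList (s :: w :: l) f (σ v) = f v := by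
      intro w l hsw hc hl ht
      refine ⟨List.isChain_cons_cons.2 ⟨hsw, hc⟩, ?_, fun v => ?_⟩
      · rw [List.getLast?_cons_cons, hl]; simp
      · simpa [transformList, swapC_eq_comp_swap] using ht (Equiv.swap s w v)
    by_cases hσs : σ s = s
    · by_cases hR : ∃ w ∈ R, w ≠ s
      · obtain ⟨w, hw, hws⟩ := hR
        have hnot : ¬ σ.SameCycle s w := by
          rintro ⟨k, hk⟩
          exact hws (hk.symm.trans (Equiv.Perm.zpow_apply_eq_self_of_apply_eq_self hσs k))
        have hLsw : L s ≠ L w := fun e => hnot (hL s hs w hw e)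
        obtain ⟨hsw, hcoarse⟩ := sameCycle_mul_swap_of_not_sameCycle hnot
        let L' : V → α := fun v => if L v = L w then L s else L v
        have himage : R.image L' ⊆ (R.image L).erase (L w) := by
          intro c hc
          obtain ⟨v, hv, rfl⟩ := Finset.mem_image.1 hc
          simp only [L']
          split_ifs with h
          · exact Finset.mem_erase.2 ⟨hLsw, Finset.mem_image_of_mem L hs⟩
          · exact Finset.mem_erase.2 ⟨h, Finset.mem_image_of_mem L hv⟩
        have hcard : (R.image L').card + 1 ≤ (R.image L).card := by
          rw [← Finset.card_erase_add_one (Finset.mem_image_of_mem L hw)]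
          exact Nat.succ_le_succ (Finset.card_le_card himage)
        obtain ⟨l, hc, hl, hcov, ht, hlen⟩ :=
          ih R L' (σ * Equiv.swap s w) (swapC f s w) w (by omega) hw
            (fun v hv => by
              have hvs : v ≠ s := fun e => hv (e ▸ hs)
              have hvw : v ≠ w := fun e => hv (e ▸ hw)
              simp [Equiv.swap_apply_of_ne_of_ne hvs hvw, hfix v hv])
            (fun a ha b hb hab => by
              simp only [L'] at hab
              split_ifs at hab with h₁ h₂ h₂
              · exact hcoarse a b (hL a ha b hb (h₁.trans h₂.symm))
              · exact (hcoarse a w (hL a ha w hw h₁)).trans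
                  (hsw.symm.trans (hcoarse s b (hL s hs b hb hab)))
              · exact (hcoarse a s (hL a ha s hs hab)).trans
                  (hsw.trans (hcoarse w b (hL w hw b hb h₂.symm)))
              · exact hcoarse a b (hL a ha b hb hab))
        obtain ⟨hc', hl', ht'⟩ := extend w l hws.symm hc hl ht
        exact ⟨w :: l, hc', hl', fun v hv => List.mem_cons_of_mem _ (hcov v hv), ht', by
          simp only [List.length_cons]; omega⟩
      · push Not at hR
        have hσ : ∀ v, σ v = v := fun v => by
          by_cases hv : v ∈ R
          · rw [hR v hv, hσs]
          · exact hfix v hv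
        have h₁ := Finset.card_pos.2 ⟨s, hs⟩
        have h₂ := Finset.card_pos.2 ⟨L s, Finset.mem_image_of_mem L hs⟩
        exact ⟨[], by simp, by simp [hσs], fun v hv => by simp [hR v hv],
          fun v => by simp [transformList, hσ], by simp only [List.length_nil]; omega⟩
    · obtain ⟨w, hw⟩ := σ.surjective s
      have hws : w ≠ s := by rintro rfl; exact hσs hw
      have hwR : w ∈ R := by
        by_contra h
        exact hws ((hfix w h).symm.trans hw)
      have hcard := Finset.card_erase_add_one hs
      have himage : ((R.erase s).image L).card ≤ (R.image L).card :=
        Finset.card_le_card (Finset.image_subset_image (Finset.erase_subset s R))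
      obtain ⟨l, hc, hl, hcov, ht, hlen⟩ :=
        ih (R.erase s) L (σ * Equiv.swap s w) (swapC f s w) w (by omega)
          (Finset.mem_erase.2 ⟨hws, hwR⟩)
          (fun v hv => by
            by_cases hvs : v = s
            · simp [hvs, hw]
            · have hvR : v ∉ R := fun h => hv (Finset.mem_erase.2 ⟨hvs, h⟩)
              have hvw : v ≠ w := fun e => hvR (e ▸ hwR)
              simp [Equiv.swap_apply_of_ne_of_ne hvs hvw, hfix v hvR])
          (fun a ha b hb hab => by
            rw [Finset.mem_erase] at ha hb
            exact sameCycle_mul_swap_of_apply_eq hw ha.1 hb.1 (hL a ha.2 b hb.2 hab))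
      obtain ⟨hc', hl', ht'⟩ := extend w l hws.symm hc hl ht
      refine ⟨w :: l, hc', hl', fun v hv => ?_, ht', by simp only [List.length_cons]; omega⟩
      by_cases hvs : v = s
      · simp [hvs]
      · exact List.mem_cons_of_mem _ (hcov v (Finset.mem_erase.2 ⟨hvs, hv⟩))

/-- Balanced colorings that agree outside `R` differ by a permutation supported in `R`. -/
theorem exists_perm_of_balanced {V C : Type*} [Fintype V] [DecidableEq V] [DecidableEq C]
    {f f' : V → C} {R : Finset V}
    (hbal : ∀ c : C, (Finset.univ.filter (fun v => f v = c)).card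
      = (Finset.univ.filter (fun v => f' v = c)).card)
    (hR : ∀ v, v ∉ R → f v = f' v) :
    ∃ σ : Equiv.Perm V, (∀ v, f' (σ v) = f v) ∧ ∀ v, v ∉ R → σ v = v := by
  have hcard : ∀ c, (R.filter (fun v => f v = c)).card = (R.filter (fun v => f' v = c)).card := by
    intro c
    have split : ∀ g : V → C, (Finset.univ.filter (fun v => g v = c)).card =
        (R.filter (fun v => g v = c)).card + (Rᶜ.filter (fun v => g v = c)).card := fun g => by
      rw [← Finset.card_union_of_disjoint
        (Finset.disjoint_filter_filter disjoint_compl_right), ← Finset.filter_union,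
        Finset.union_compl]
    have hcompl : Rᶜ.filter (fun v => f v = c) = Rᶜ.filter (fun v => f' v = c) :=
      Finset.filter_congr fun v hv => by rw [hR v (Finset.mem_compl.1 hv)]
    have h := hbal c
    rw [split f, split f', hcompl] at h
    exact Nat.add_right_cancel h
  have hfiber : ∀ (g : V → C) (c : C),
      Fintype.card {v : {v // v ∈ R} // g v = c} = (R.filter (fun v => g v = c)).card := by
    intro g c
    rw [Fintype.card_congr (Equiv.subtypeSubtypeEquivSubtypeInter (· ∈ R) (fun v => g v = c)),
      Fintype.card_subtype]
    congr 1
    ext v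
    simp
  let e : Equiv.Perm {v // v ∈ R} :=
    Equiv.ofFiberEquiv (f := fun v : {v // v ∈ R} => f v) (g := fun v : {v // v ∈ R} => f' v)
      fun c => Fintype.equivOfCardEq (by rw [hfiber f c, hfiber f' c, hcard c])
  refine ⟨Equiv.Perm.ofSubtype e, fun v => ?_, fun v hv =>
    Equiv.Perm.ofSubtype_apply_of_not_mem e hv⟩
  by_cases hv : v ∈ R
  · rw [Equiv.Perm.ofSubtype_apply_of_mem e hv]
    exact Equiv.ofFiberEquiv_map (f := fun v : {v // v ∈ R} => f v)
      (g := fun v : {v // v ∈ R} => f' v) _ ⟨v, hv⟩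
  · rw [Equiv.Perm.ofSubtype_apply_of_not_mem e hv, hR v hv]

/-- The permutation relating two balanced colorings can be chosen so that points of `R` with the
same color lie in the same cycle. -/
theorem exists_perm_sameCycle_of_balanced {V C : Type*} [Fintype V] [DecidableEq V]
    [DecidableEq C] {f f' : V → C} {R : Finset V}
    (hbal : ∀ c : C, (Finset.univ.filter (fun v => f v = c)).card
      = (Finset.univ.filter (fun v => f' v = c)).card)
    (hR : ∀ v, v ∉ R → f v = f' v) :
    ∃ σ : Equiv.Perm V, (∀ v, f' (σ v) = f v) ∧ (∀ v, v ∉ R → σ v = v) ∧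
      ∀ u ∈ R, ∀ v ∈ R, f u = f v → σ.SameCycle u v := by
  obtain ⟨σ, ⟨hσ, hfix⟩, hmax⟩ := Set.exists_max_image
    {σ : Equiv.Perm V | (∀ v, f' (σ v) = f v) ∧ ∀ v, v ∉ R → σ v = v}
    (fun σ => Set.ncard {p : V × V | σ.SameCycle p.1 p.2}) (Set.toFinite _)
    (exists_perm_of_balanced hbal hR)
  refine ⟨σ, hσ, hfix, fun u hu v hv huv => ?_⟩
  by_contra hnot
  obtain ⟨hcycle, hcoarse⟩ := sameCycle_mul_swap_of_not_sameCycle hnot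
  refine absurd (hmax (σ * Equiv.swap u v) ⟨fun x => ?_, fun x hx => ?_⟩) (not_le.2 ?_)
  · rw [Equiv.Perm.mul_apply, hσ, Equiv.swap_apply_def]
    split_ifs with h₁ h₂
    · rw [h₁, huv]
    · rw [h₂, huv]
    · rfl
  · have hxu : x ≠ u := fun e => hx (e ▸ hu)
    have hxv : x ≠ v := fun e => hx (e ▸ hv)
    simp [Equiv.swap_apply_of_ne_of_ne hxu hxv, hfix x hx]
  · exact Set.ncard_lt_ncard
      ⟨fun p hp => hcoarse p.1 p.2 hp, fun h => hnot (h (a := (u, v)) hcycle)⟩ (Set.toFinite _)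

/-- upper bound on complete graphs: under the complete-graph
setup there is a walk `W` from `s` to `t` in the complete graph `K` visiting
all of `P` that transforms `f` into `f′` and has length at most
`|R| + cc - 2`. -/
theorem complete_upper_bound {V C : Type*} [Fintype V] [DecidableEq V]
    [DecidableEq C] (f f' : V → C) (s t : V) (P : Finset V) (z : C)
    (hbal : ∀ c : C, (Finset.univ.filter (fun v => f v = c)).card
      = (Finset.univ.filter (fun v => f' v = c)).card)
    (hfs : f s = z) (hft : f' t = z)
    (hfz : ∀ v, v ≠ s → f v ≠ z) (hf'z : ∀ v, v ≠ t → f' v ≠ z) :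
    let R : Finset V := Finset.univ.filter (fun v => f v ≠ f' v) ∪ {s, t} ∪ P
    let S : Finset C := R.image f
    let r : C → C → Prop := fun a b => ∃ v ∈ R, f v = a ∧ f' v = b
    let cc : ℕ := Set.ncard
      {T : Set C | ∃ c ∈ S, T = {d | d ∈ S ∧ Relation.EqvGen r c d}}
    ∃ l : List V, l.Chain' (⊤ : SimpleGraph V).Adj ∧ l.head? = some s ∧
      l.getLast? = some t ∧ (∀ v ∈ P, v ∈ l) ∧ transformList l f = f' ∧
      l.length - 1 ≤ R.card + cc - 2 := by
  intro R S r cc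
  have hR : ∀ v, v ∉ R → f v = f' v := fun v hv => by
    by_contra h
    exact hv (by simp [R, h])
  have hsR : s ∈ R := by simp [R]
  obtain ⟨σ, hσ, hfix, hcolor⟩ := exists_perm_sameCycle_of_balanced hbal hR
  have hσs : σ s = t := by
    by_contra h
    exact hf'z _ h ((hσ s).trans hfs)
  have hclass : ∀ c d, Relation.EqvGen r c d → ((∃ a ∈ R, f a = c) ↔ ∃ b ∈ R, f b = d) ∧
      ∀ a ∈ R, ∀ b ∈ R, f a = c → f b = d → σ.SameCycle a b := by
    intro c d h
    induction h with
    | rel c d h =>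
      obtain ⟨v, hv, rfl, rfl⟩ := h
      obtain ⟨u, rfl⟩ := σ.surjective v
      have hu : u ∈ R := by
        by_contra hu
        exact hu (hfix u hu ▸ hv)
      refine ⟨⟨fun _ => ⟨u, hu, (hσ u).symm⟩, fun _ => ⟨σ u, hv, rfl⟩⟩, fun a ha b hb hac hbd => ?_⟩
      have hub : σ.SameCycle u b := hcolor u hu b hb ((hσ u).symm.trans hbd.symm)
      exact (hcolor a ha _ hv hac).trans (Equiv.Perm.sameCycle_apply_left.2 hub)
    | refl c => exact ⟨Iff.rfl, fun a ha b hb hac hbc => hcolor a ha b hb (hac.trans hbc.symm)⟩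
    | symm c d _ ih =>
      exact ⟨ih.1.symm, fun a ha b hb hac hbd => (ih.2 b hb a ha hbd hac).symm⟩
    | trans c d e _ _ ih₁ ih₂ =>
      refine ⟨ih₁.1.trans ih₂.1, fun a ha b hb hac hbe => ?_⟩
      obtain ⟨m, hm, hmd⟩ := ih₁.1.1 ⟨a, ha, hac⟩
      exact (ih₁.2 a ha m hm hac hmd).trans (ih₂.2 m hm b hb hmd hbe)
  classical
  let L : V → Set C := fun v => {d | d ∈ S ∧ Relation.EqvGen r (f v) d}
  have hcc : cc = (R.image L).card := by
    rw [← Set.ncard_coe_finset]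
    refine congrArg Set.ncard (Set.ext fun T => ?_)
    simp only [S, L, Set.mem_ofPred_eq, Finset.coe_image, Set.mem_image, Finset.mem_coe,
      Finset.mem_image]
    constructor
    · rintro ⟨_, ⟨v, hv, rfl⟩, rfl⟩
      exact ⟨v, hv, rfl⟩
    · rintro ⟨v, hv, rfl⟩
      exact ⟨_, ⟨v, hv, rfl⟩, rfl⟩
  obtain ⟨l, hchain, hlast, hcov, htrans, hlen⟩ :=
    exists_walk_of_perm _ R L σ f s le_rfl hsR hfix fun a ha b hb hab => by
      have hb' : f b ∈ L b := ⟨Finset.mem_image_of_mem f hb, Relation.EqvGen.refl _⟩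
      rw [← hab] at hb'
      exact (hclass _ _ hb'.2).2 a ha b hb rfl rfl
  refine ⟨s :: l, hchain.imp fun _ _ h => h, rfl, hσs ▸ hlast,
    fun v hv => hcov v (by simp [R, hv]), funext fun v => ?_, ?_⟩
  · obtain ⟨u, rfl⟩ := σ.surjective v
    rw [htrans, hσ]
  · simp only [List.length_cons]
    omega
end

section
/- Under the stated complete-graph setup, the minimum length of a walk W in K from s to t such that every vertex of P occurs in W and W transforms f into f′ is exactly |R| + cc − 2 (in particular, such a walk exists). -/
theorem transformList_eq_comp_formPerm {V C : Type*} [DecidableEq V] (l : List V) (f : V → C) :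
    transformList l f = f ∘ l.formPerm := by
  induction l, f using transformList.induct with
  | case1 f => rfl
  | case2 a f => rfl
  | case3 a b l f ih =>
    rw [transformList, ih, swapC_eq_comp_swap, List.formPerm_cons_cons, Equiv.Perm.coe_mul,
      Function.comp_assoc]

theorem formPerm_append_cons {V : Type*} [DecidableEq V] (l : List V) (a : V) (m : List V) :
    (l ++ a :: m).formPerm = (l ++ [a]).formPerm * (a :: m).formPerm := by
  induction l with
  | nil => simp
  | cons x l ih =>
    cases l with
    | nil => simp
    | cons y l => simpa [mul_assoc] using ih

/-- A vertex keeps the color it receives at its last exit along a walk. -/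
theorem formPerm_getElem_of_notMem_drop {V : Type*} [DecidableEq V] {l : List V} {i : ℕ}
    (hi : i + 1 < l.length) (h : l[i] ∉ l.drop (i + 1)) :
    l.formPerm l[i] = (l.take (i + 1)).formPerm l[i + 1] := by
  have h1 : l.take i ++ l[i] :: l.drop (i + 1) = l := by simp
  have h2 : l.drop (i + 1) = l[i + 1] :: l.drop (i + 2) := by simp
  have h3 : l.formPerm = (l.take (i + 1)).formPerm *
      (Equiv.swap l[i] l[i + 1] * (l.drop (i + 1)).formPerm) := by
    conv_lhs => rw [← h1, formPerm_append_cons, h2, List.formPerm_cons_cons, ← h2]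
    simp
  rw [h3, Equiv.Perm.mul_apply, Equiv.Perm.mul_apply, List.formPerm_apply_of_notMem h,
    Equiv.swap_apply_left]

/-- Every vertex of `R` has a first visit, and the last exit from every color class avoiding `f' t`
is followed by a visit that is not such a first visit. -/
theorem card_add_card_le_length {V C Q : Type*} [DecidableEq V] [DecidableEq Q]
    {l : List V} {R : Finset V} (hR : ∀ v ∈ R, v ∈ l) {f f' : V → C} (hl : f ∘ l.formPerm = f')
    {q : C → Q} (hq : ∀ v ∈ R, q (f v) = q (f' v)) {t : V}
    (ht : l.getLast? = some t) :
    R.card + ((R.image fun v => q (f v)).erase (q (f' t))).card ≤ l.length := by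
  let I : Finset (Fin l.length) := {j | l[j] ∈ R ∧ l[j] ∉ l.take j}
  have h1 : R.card ≤ I.card := by
    refine (Finset.card_le_card fun v hv => ?_).trans (Finset.card_image_le (f := fun j : Fin l.length => l[j]))
    obtain ⟨as, bs, h, hn⟩ := List.eq_append_cons_of_mem (hR v hv)
    refine Finset.mem_image.2 ⟨⟨as.length, by simp [h]⟩, ?_, ?_⟩ <;> simp [I, h, hv, hn]
  have h2 : ((R.image fun v => q (f v)).erase (q (f' t))).card ≤ Iᶜ.card := by
    refine (Finset.card_le_card fun T hT => ?_).trans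
      (Finset.card_image_le (f := fun j : Fin l.length => q (f ((l.take j).formPerm l[j]))))
    obtain ⟨hTt, hTR⟩ := Finset.mem_erase.1 hT
    obtain ⟨u, hu, huT⟩ := Finset.mem_image.1 hTR
    let E : Finset (Fin l.length) := {j | l[j] ∈ R ∧ q (f l[j]) = T}
    have hE : E.Nonempty := by
      obtain ⟨i, hi, rfl⟩ := List.getElem_of_mem (hR u hu)
      exact ⟨⟨i, hi⟩, by simp [E, hu, huT]⟩
    obtain ⟨⟨i, hi⟩, hiE, hmax⟩ : ∃ i ∈ E, ∀ j ∈ E, j ≤ i :=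
      ⟨E.max' hE, E.max'_mem hE, fun j hj => E.le_max' j hj⟩
    obtain ⟨hiR, hiT⟩ : l[i] ∈ R ∧ q (f l[i]) = T := by simpa [E] using hiE
    have hi1 : i + 1 < l.length := by
      by_contra hcon
      have : l[i] = t := by
        rw [List.getLast?_eq_getElem?, List.getElem?_eq_some_iff] at ht
        obtain ⟨h, rfl⟩ := ht
        congr 1
        omega
      rw [hq _ hiR, this] at hiT
      exact hTt hiT.symm
    have hlast : ∀ (j : ℕ) (hj : j < l.length), i < j → l[j] ∈ R → q (f l[j]) ≠ T := by
      intro j hj hij h h'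
      have := hmax ⟨j, hj⟩ (by simp [E, h, h'])
      simp only [Fin.mk_le_mk] at this
      omega
    have hdrop : l[i] ∉ l.drop (i + 1) := by
      intro hmem
      obtain ⟨k, hk, hkeq⟩ := List.getElem_of_mem hmem
      rw [List.getElem_drop] at hkeq
      exact hlast (i + 1 + k) (by simp at hk; omega) (by omega) (by rwa [hkeq]) (by rwa [hkeq])
    have hcol : q (f ((l.take (i + 1)).formPerm l[i + 1])) = T := by
      rw [← formPerm_getElem_of_notMem_drop hi1 hdrop, ← hiT, hq _ hiR, ← hl]
      rfl
    refine Finset.mem_image.2 ⟨⟨i + 1, hi1⟩, ?_, hcol⟩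
    simp only [I, Finset.mem_compl, Finset.mem_filter, Finset.mem_univ, true_and, Fin.getElem_fin]
    rintro ⟨hR', hnot⟩
    rw [List.formPerm_apply_of_notMem hnot] at hcol
    exact hlast (i + 1) hi1 (by omega) hR' hcol
  have h3 := Finset.card_add_card_compl I
  rw [Fintype.card_fin] at h3
  omega

/-- A cyclic list of distinct vertices of `A` along which the target color of every vertex is the
initial color of the next one. -/
def IsClosedTrail {V C : Type*} (f f' : V → C) (A : Finset V) (L : List V) : Prop :=
  L.Nodup ∧ (∀ x ∈ L, x ∈ A) ∧ (L : Cycle V).Chain (fun a b => f' a = f b)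

namespace IsClosedTrail

variable {V C : Type*} {f f' : V → C} {A : Finset V} {L M : List V}

theorem of_isRotated (h : IsClosedTrail f f' A L) (hr : L ~r M) : IsClosedTrail f f' A M :=
  ⟨hr.nodup_iff.1 h.1, fun x hx => h.2.1 x (hr.mem_iff.2 hx), Cycle.coe_eq_coe.2 hr ▸ h.2.2⟩

theorem exists_isRotated_cons {x : V} (hx : x ∈ L) : ∃ m, L ~r x :: m := by
  obtain ⟨as, bs, rfl⟩ := List.append_of_mem hx
  exact ⟨bs ++ as, List.isRotated_append⟩

theorem apply_formPerm [DecidableEq V] (h : IsClosedTrail f f' A L) {x : V} (hx : x ∈ L) :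
    f (L.formPerm x) = f' x := by
  obtain ⟨m, hm⟩ := exists_isRotated_cons hx
  rw [List.formPerm_eq_of_isRotated h.1 hm]
  obtain ⟨hn, -, hc⟩ := h.of_isRotated hm
  rw [Cycle.chain_coe_cons] at hc
  cases m with
  | nil => simpa [eq_comm] using hc
  | cons y m =>
    rw [List.formPerm_apply_head _ _ _ hn]
    simp only [List.cons_append, List.isChain_cons_cons] at hc
    exact hc.1.symm

theorem card_filter_eq [DecidableEq V] [DecidableEq C] (h : IsClosedTrail f f' A L) (c : C) :
    (L.toFinset.filter fun v => f v = c).card = (L.toFinset.filter fun v => f' v = c).card := by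
  symm
  refine Finset.card_equiv L.formPerm fun v => ?_
  simp only [Finset.mem_filter, List.mem_toFinset, List.formPerm_mem_iff_mem]
  exact and_congr_right fun hv => by rw [h.apply_formPerm hv]

theorem append {v w : V} {m k : List V} (h : IsClosedTrail f f' A (v :: m))
    (h' : IsClosedTrail f f' A (w :: k)) (hd : (v :: m).Disjoint (w :: k)) (hvw : f v = f w) :
    IsClosedTrail f f' A (v :: m ++ w :: k) := by
  refine ⟨h.1.append h'.1 hd, fun x hx => ?_, ?_⟩
  · rcases List.mem_append.1 hx with hx | hx
    exacts [h.2.1 x hx, h'.2.1 x hx]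
  · have h1 := h.2.2
    have h2 := h'.2.2
    rw [Cycle.chain_coe_cons] at h1 h2
    rw [List.cons_append, Cycle.chain_coe_cons]
    rw [← List.cons_append, List.isChain_append] at h1 h2
    simp only [← List.cons_append, List.append_assoc, List.isChain_append]
    simp only [List.head?_append] at *
    simp_all

theorem mono {B : Finset V} (h : IsClosedTrail f f' A L) (hAB : A ⊆ B) :
    IsClosedTrail f f' B L :=
  ⟨h.1, fun x hx => hAB (h.2.1 x hx), h.2.2⟩

theorem exists_cons [DecidableEq C]
    (hbal : ∀ c, (A.filter fun v => f v = c).card = (A.filter fun v => f' v = c).card)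
    {w : V} (hw : w ∈ A) : ∃ m, IsClosedTrail f f' A (w :: m) := by
  have e : ∀ c, Nonempty ({a : A // f' a = c} ≃ {a : A // f a = c}) := fun c => by
    refine ⟨Fintype.equivOfCardEq ?_⟩
    have key : ∀ g : V → C, Fintype.card {a : A // g a = c} = (A.filter fun v => g v = c).card := by
      intro g
      rw [Fintype.card_subtype, ← Finset.card_map (Function.Embedding.subtype _)]
      congr 1
      ext v
      simp [and_comm]
    rw [key f', key f, hbal]
  let σ : Equiv.Perm A := Equiv.ofFiberEquiv fun c => (e c).some
  have hσ : ∀ a, f (σ a) = f' a := Equiv.ofFiberEquiv_map (f := fun a : A => f' a)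
    (g := fun a : A => f a) _
  have hper : (⟨w, hw⟩ : A) ∈ Function.periodicPts σ := σ.injective.mem_periodicPts _
  let L : List A := (List.range (Function.minimalPeriod σ ⟨w, hw⟩)).map fun n => σ^[n] ⟨w, hw⟩
  have hL : (L : Cycle A) = Function.periodicOrbit σ ⟨w, hw⟩ := rfl
  have hT : IsClosedTrail f f' A (L.map Subtype.val) := by
    refine ⟨?_, ?_, ?_⟩
    · rw [List.nodup_map_iff Subtype.val_injective, ← Cycle.nodup_coe_iff, hL]
      exact Function.nodup_periodicOrbit
    · intro x hx
      obtain ⟨y, -, rfl⟩ := List.mem_map.1 hx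
      exact y.2
    · rw [← Cycle.map_coe, Cycle.chain_map, hL, Function.periodicOrbit_chain]
      intro n _
      rw [Function.iterate_succ_apply', hσ]
  have hwL : w ∈ L.map Subtype.val := by
    have := Function.self_mem_periodicOrbit hper
    rw [← hL, Cycle.mem_coe_iff] at this
    exact List.mem_map.2 ⟨_, this, rfl⟩
  obtain ⟨m, hm⟩ := exists_isRotated_cons hwL
  exact ⟨m, hT.of_isRotated hm⟩

theorem exists_longer [DecidableEq V] [DecidableEq C]
    (hbal : ∀ c, (A.filter fun v => f v = c).card = (A.filter fun v => f' v = c).card)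
    (hconn : ∀ X : Set C, (∀ v ∈ A, f v ∈ X ↔ f' v ∈ X) → ∀ v ∈ A, ∀ w ∈ A, f v ∈ X → f w ∈ X)
    (h : IsClosedTrail f f' A L) (hne : L ≠ []) (hlt : L.length < A.card) :
    ∃ M, IsClosedTrail f f' A M ∧ L.length < M.length := by
  have hsub : L.toFinset ⊆ A := fun x hx => h.2.1 x (List.mem_toFinset.1 hx)
  have hbal' : ∀ c, ((A \ L.toFinset).filter fun v => f v = c).card =
      ((A \ L.toFinset).filter fun v => f' v = c).card := by
    intro c
    have key : ∀ g : V → C, ((A \ L.toFinset).filter fun v => g v = c).card +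
        (L.toFinset.filter fun v => g v = c).card = (A.filter fun v => g v = c).card := by
      intro g
      rw [← Finset.card_union_of_disjoint
        (Finset.disjoint_filter_filter Finset.sdiff_disjoint), ← Finset.filter_union,
        Finset.sdiff_union_of_subset hsub]
    have h1 := key f
    have h2 := key f'
    have h3 := h.card_filter_eq c
    have h4 := hbal c
    omega
  obtain ⟨v, hv, w, hw, hvw⟩ : ∃ v ∈ L, ∃ w ∈ A \ L.toFinset, f v = f w := by
    by_contra! hcon
    obtain ⟨v, hv⟩ := List.exists_mem_of_ne_nil L hne
    obtain ⟨w, hwA, hwL⟩ : ∃ w ∈ A, w ∉ L := by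
      by_contra! hall
      have : A.card ≤ L.toFinset.card :=
        Finset.card_le_card fun x hx => List.mem_toFinset.2 (hall x hx)
      exact absurd (this.trans (List.toFinset_card_le L)) (by omega)
    have hclosed : ∀ x ∈ A, f x ∈ {c | ∃ u ∈ L, f u = c} ↔ f' x ∈ {c | ∃ u ∈ L, f u = c} := by
      intro x hx
      by_cases hxL : x ∈ L
      · exact iff_of_true ⟨x, hxL, rfl⟩
          ⟨L.formPerm x, List.formPerm_apply_mem_of_mem hxL, h.apply_formPerm hxL⟩
      · refine iff_of_false ?_ ?_
        · rintro ⟨u, hu, hux⟩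
          exact hcon u hu x (by simp [hx, hxL]) hux
        · rintro ⟨u, hu, hux⟩
          have hpos : 0 < ((A \ L.toFinset).filter fun y => f y = f' x).card := by
            rw [hbal']
            exact Finset.card_pos.2 ⟨x, by simp [hx, hxL]⟩
          obtain ⟨y, hy⟩ := Finset.card_pos.1 hpos
          rw [Finset.mem_filter] at hy
          exact hcon u hu y hy.1 (hux.trans hy.2.symm)
    obtain ⟨u, hu, huw⟩ := hconn _ hclosed v (h.2.1 v hv) w hwA ⟨v, hv, rfl⟩
    exact hcon u hu w (by simp [hwA, hwL]) huw
  obtain ⟨m, hm⟩ := exists_isRotated_cons hv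
  obtain ⟨k, hk⟩ := exists_cons hbal' hw
  refine ⟨v :: m ++ w :: k, (h.of_isRotated hm).append (hk.mono Finset.sdiff_subset) ?_ hvw, ?_⟩
  · intro x hx hx'
    exact (Finset.mem_sdiff.1 (hk.2.1 x hx')).2 (List.mem_toFinset.2 (hm.mem_iff.2 hx))
  · rw [hm.perm.length_eq, List.length_append, List.length_cons (a := w)]
    omega

/-- A balanced and connected set of vertices, seen as directed edges `f v → f' v` between colors,
has an Eulerian circuit starting at any of its elements. -/
theorem exists_eulerian [DecidableEq V] [DecidableEq C]
    (hbal : ∀ c, (A.filter fun v => f v = c).card = (A.filter fun v => f' v = c).card)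
    (hconn : ∀ X : Set C, (∀ v ∈ A, f v ∈ X ↔ f' v ∈ X) → ∀ v ∈ A, ∀ w ∈ A, f v ∈ X → f w ∈ X)
    {w : V} (hw : w ∈ A) : ∃ m, IsClosedTrail f f' A (w :: m) ∧ (w :: m).toFinset = A := by
  have key : ∀ n, n + 1 ≤ A.card → ∃ L, IsClosedTrail f f' A L ∧ n + 1 ≤ L.length := by
    intro n
    induction n with
    | zero =>
      obtain ⟨m, hm⟩ := exists_cons hbal hw
      exact fun _ => ⟨_, hm, by simp⟩
    | succ n ih =>
      intro hn
      obtain ⟨L, hL, hlen⟩ := ih (by omega)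
      by_cases hlt : L.length < A.card
      · obtain ⟨M, hM, hLM⟩ := hL.exists_longer hbal hconn (by rintro rfl; simp at hlen) hlt
        exact ⟨M, hM, by omega⟩
      · exact ⟨L, hL, by omega⟩
  have hpos := Finset.card_pos.2 ⟨w, hw⟩
  obtain ⟨L, hL, hlen⟩ := key (A.card - 1) (by omega)
  have hLA : L.toFinset = A :=
    Finset.eq_of_subset_of_card_le (fun x hx => hL.2.1 x (List.mem_toFinset.1 hx))
      (by rw [List.toFinset_card_of_nodup hL.1]; omega)
  obtain ⟨m, hm⟩ := exists_isRotated_cons (List.mem_toFinset.1 (hLA ▸ hw : w ∈ L.toFinset))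
  refine ⟨m, hL.of_isRotated hm, ?_⟩
  rw [← hLA]
  ext x
  simp only [List.mem_toFinset, hm.mem_iff]

end IsClosedTrail

theorem formPerm_cons_append_self {V : Type*} [DecidableEq V] {s : V} {l : List V}
    (h : (s :: l).Nodup) : (s :: (l ++ [s])).formPerm = l.formPerm := by
  cases l with
  | nil =>
    rw [List.nil_append, List.formPerm_pair, Equiv.swap_self]
    rfl
  | cons w m =>
    have hr : w :: m ++ [s] ~r s :: w :: m := List.isRotated_append
    rw [List.cons_append, List.formPerm_cons_cons, ← List.cons_append,
      List.formPerm_eq_of_isRotated (hr.nodup_iff.2 h) hr, List.formPerm_cons_cons, ← mul_assoc,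
      Equiv.swap_mul_self, one_mul]

/-- The walk `l` permutes `B`, produces the coloring `f'` there and changes nothing elsewhere. -/
def RealizesOn {V C : Type*} [DecidableEq V] (f f' : V → C) (l : List V) (B : Finset V) : Prop :=
  (∀ v ∈ B, l.formPerm v ∈ B ∧ f (l.formPerm v) = f' v) ∧ ∀ v ∉ B, l.formPerm v = v

theorem IsClosedTrail.realizesOn {V C : Type*} [DecidableEq V] {f f' : V → C} {A : Finset V}
    {L : List V} (h : IsClosedTrail f f' A L) (hA : L.toFinset = A) : RealizesOn f f' L A := by
  subst hA
  refine ⟨fun v hv => ?_, fun v hv => ?_⟩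
  · rw [List.mem_toFinset] at hv ⊢
    exact ⟨List.formPerm_apply_mem_of_mem hv, h.apply_formPerm hv⟩
  · exact List.formPerm_apply_of_notMem fun hv' => hv (List.mem_toFinset.2 hv')

theorem RealizesOn.of_formPerm_eq_mul {V C : Type*} [DecidableEq V] {f f' : V → C}
    {l₁ l₂ l : List V} {B₁ B₂ : Finset V} (h₁ : RealizesOn f f' l₁ B₁)
    (h₂ : RealizesOn f f' l₂ B₂) (hd : Disjoint B₁ B₂)
    (hl : l.formPerm = l₁.formPerm * l₂.formPerm) : RealizesOn f f' l (B₁ ∪ B₂) := by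
  rw [Finset.disjoint_left] at hd
  refine ⟨fun v hv => ?_, fun v hv => ?_⟩
  · rw [hl, Equiv.Perm.mul_apply]
    by_cases hv₁ : v ∈ B₁
    · rw [h₂.2 v (hd hv₁)]
      exact ⟨Finset.mem_union_left _ (h₁.1 v hv₁).1, (h₁.1 v hv₁).2⟩
    · have hv₂ := h₂.1 v ((Finset.mem_union.1 hv).resolve_left hv₁)
      rw [h₁.2 _ fun h => hd h hv₂.1]
      exact ⟨Finset.mem_union_right _ hv₂.1, hv₂.2⟩
  · rw [Finset.mem_union, not_or] at hv
    rw [hl, Equiv.Perm.mul_apply, h₂.2 v hv.2, h₁.2 v hv.1]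

/-- Concatenation of the Eulerian circuits of the classes in `𝒯`, each entered from `s` and left
back to `s`, with the circuit of the class of `f s`. -/
theorem exists_walk_of_classes {V C Q : Type*} [DecidableEq V] [DecidableEq Q] {f f' : V → C}
    {R : Finset V} {q : C → Q} {s t : V}
    (hcirc : ∀ w ∈ R, ∃ m, IsClosedTrail f f' (R.filter fun v => q (f v) = q (f w)) (w :: m) ∧
      (w :: m).toFinset = R.filter fun v => q (f v) = q (f w))
    (hs : s ∈ R) (ht : ∀ v, v ≠ t → f' v ≠ f s) (𝒯 : Finset Q)
    (h𝒯 : 𝒯 ⊆ (R.image fun v => q (f v)).erase (q (f s))) :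
    ∃ l : List V, l.IsChain (· ≠ ·) ∧ l.head? = some s ∧ l.getLast? = some t ∧
      (∀ v ∈ R.filter fun v => q (f v) ∈ insert (q (f s)) 𝒯, v ∈ l) ∧
      RealizesOn f f' l (R.filter fun v => q (f v) ∈ insert (q (f s)) 𝒯) ∧
      l.length = (R.filter fun v => q (f v) ∈ insert (q (f s)) 𝒯).card + 𝒯.card := by
  induction 𝒯 using Finset.induction_on with
  | empty =>
    obtain ⟨m, hm, hmA⟩ := hcirc s hs
    simp only [insert_empty_eq, Finset.mem_singleton, Finset.card_empty, add_zero]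
    refine ⟨s :: m, hm.1.isChain, rfl, ?_, fun v hv => ?_, hm.realizesOn hmA, ?_⟩
    · have hc := hm.2.2
      rw [Cycle.chain_coe_cons, ← List.cons_append, List.isChain_append] at hc
      rw [List.getLast?_eq_some_getLast (List.cons_ne_nil s m), Option.some_inj]
      by_contra hne
      exact ht _ hne (hc.2.2 _ (List.getLast?_eq_some_getLast (List.cons_ne_nil s m)) s (by simp))
    · rwa [← hmA, List.mem_toFinset] at hv
    · rw [← hmA, List.toFinset_card_of_nodup hm.1]
  | insert T 𝒯 hT ih =>
    obtain ⟨l, hne, hhead, hlast, hmem, hreal, hlen⟩ :=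
      ih ((Finset.subset_insert _ _).trans h𝒯)
    obtain ⟨hTs, hTR⟩ := Finset.mem_erase.1 (h𝒯 (Finset.mem_insert_self T 𝒯))
    obtain ⟨w, hw, rfl⟩ := Finset.mem_image.1 hTR
    obtain ⟨m, hm, hmA⟩ := hcirc w hw
    obtain ⟨r, rfl⟩ : ∃ r, l = s :: r := by
      cases l with
      | nil => simp at hhead
      | cons a r => simp at hhead; exact ⟨r, by rw [hhead]⟩
    have hsm : (s :: w :: m).Nodup := List.nodup_cons.2 ⟨fun h => hTs (by
      simpa [eq_comm] using (Finset.mem_filter.1 (hm.2.1 s h)).2), hm.1⟩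
    have hB : (R.filter fun v => q (f v) ∈ insert (q (f s)) (insert (q (f w)) 𝒯)) =
        (R.filter fun v => q (f v) = q (f w)) ∪
          R.filter fun v => q (f v) ∈ insert (q (f s)) 𝒯 := by
      rw [← Finset.filter_or]
      exact Finset.filter_congr fun v _ => by simp only [Finset.mem_insert]; tauto
    have hd : Disjoint (R.filter fun v => q (f v) = q (f w))
        (R.filter fun v => q (f v) ∈ insert (q (f s)) 𝒯) := by
      refine Finset.disjoint_filter.2 fun v _ hv => ?_
      rw [hv, Finset.mem_insert, not_or]
      exact ⟨hTs, hT⟩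
    rw [hB]
    refine ⟨s :: w :: m ++ s :: r, ?_, rfl, ?_, fun v hv => ?_, ?_, ?_⟩
    · refine List.IsChain.append hsm.isChain hne ?_
      rintro x hx y hy
      simp only [List.head?_cons, Option.mem_def, Option.some_inj] at hy
      subst hy
      rw [List.getLast?_cons_cons] at hx
      rintro rfl
      exact (List.nodup_cons.1 hsm).1 (List.mem_of_getLast? hx)
    · rw [List.getLast?_append_of_ne_nil _ (by simp), hlast]
    · rcases Finset.mem_union.1 hv with hv | hv
      · rw [← hmA, List.mem_toFinset] at hv
        exact List.mem_append_left _ (List.mem_cons_of_mem _ hv)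
      · exact List.mem_append_right _ (hmem v hv)
    · refine (hm.realizesOn hmA).of_formPerm_eq_mul hreal hd ?_
      rw [formPerm_append_cons, List.cons_append, formPerm_cons_append_self hsm]
    · rw [Finset.card_union_of_disjoint hd, List.length_append, hlen, ← hmA,
        List.toFinset_card_of_nodup hm.1, Finset.card_insert_of_notMem hT, List.length_cons]
      omega

theorem ncard_classes {C : Type*} (S : Finset C) (r : C → C → Prop) [DecidableEq (Quot r)] :
    Set.ncard {T : Set C | ∃ c ∈ S, T = {d | d ∈ S ∧ Relation.EqvGen r c d}} =
      (S.image (Quot.mk r)).card := by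
  have himage : {T : Set C | ∃ c ∈ S, T = {d | d ∈ S ∧ Relation.EqvGen r c d}} =
      (fun τ => {d | d ∈ S ∧ τ = Quot.mk r d}) '' (S.image (Quot.mk r) : Finset (Quot r)) := by
    ext T
    simp only [← Quot.eq, Finset.coe_image, Set.image_image, Set.mem_ofPred_eq, Set.mem_image,
      Finset.mem_coe, eq_comm (a := T)]
  rw [himage, Set.InjOn.ncard_image, Set.ncard_coe_finset]
  intro τ hτ τ' _ h
  obtain ⟨c, hc, rfl⟩ := Finset.mem_image.1 hτ
  have : c ∈ {d | d ∈ S ∧ τ' = Quot.mk r d} := (Set.ext_iff.1 h c).1 ⟨hc, rfl⟩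
  exact this.2.symm

theorem exists_eulerian_class {V C : Type*} [DecidableEq V] [DecidableEq C] {f f' : V → C}
    {R : Finset V} {r : C → C → Prop} [DecidableEq (Quot r)]
    (hr : ∀ a b, r a b ↔ ∃ v ∈ R, f v = a ∧ f' v = b)
    (hbal : ∀ c, (R.filter fun v => f v = c).card = (R.filter fun v => f' v = c).card)
    {w : V} (hw : w ∈ R) :
    ∃ m, IsClosedTrail f f' (R.filter fun v => Quot.mk r (f v) = Quot.mk r (f w)) (w :: m) ∧
      (w :: m).toFinset = R.filter fun v => Quot.mk r (f v) = Quot.mk r (f w) := by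
  have hq : ∀ v ∈ R, Quot.mk r (f v) = Quot.mk r (f' v) := fun v hv =>
    Quot.sound ((hr _ _).2 ⟨v, hv, rfl, rfl⟩)
  refine IsClosedTrail.exists_eulerian (fun c => ?_) (fun X hX v hv u hu hvX => ?_) (by simpa)
  · have key : ∀ g : V → C, (∀ v ∈ R, Quot.mk r (f v) = Quot.mk r (g v)) →
        ((R.filter fun v => Quot.mk r (f v) = Quot.mk r (f w)).filter fun v => g v = c) =
        if Quot.mk r c = Quot.mk r (f w) then R.filter fun v => g v = c else ∅ := by
      intro g hg
      ext v
      split_ifs with h <;> simp only [Finset.mem_filter, Finset.notMem_empty, iff_false]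
      · exact ⟨fun hv => ⟨hv.1.1, hv.2⟩, fun hv => ⟨⟨hv.1, by rw [hg v hv.1, hv.2, h]⟩, hv.2⟩⟩
      · rintro ⟨⟨hv, hvw⟩, rfl⟩
        exact h (by rw [← hg v hv, hvw])
    rw [key f fun _ _ => rfl, key f' hq]
    split_ifs
    · exact hbal c
    · rfl
  · rw [Finset.mem_filter] at hv hu
    have inv : ∀ a b, Relation.EqvGen r a b → Quot.mk r a = Quot.mk r (f w) →
        (a ∈ X ↔ b ∈ X) := by
      intro a b hab
      induction hab with
      | rel a b h =>
        obtain ⟨x, hx, rfl, rfl⟩ := (hr _ _).1 h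
        exact fun ha => hX x (Finset.mem_filter.2 ⟨hx, ha⟩)
      | refl a => exact fun _ => Iff.rfl
      | symm a b h ih => exact fun hb => (ih ((Quot.eqvGen_sound h).trans hb)).symm
      | trans a b c h h' ih ih' =>
        exact fun ha => (ih ha).trans (ih' ((Quot.eqvGen_sound h).symm.trans ha))
    exact (inv _ _ (Quot.eqvGen_exact (hv.2.trans hu.2.symm)) hv.2).1 hvX

/-- under the complete-graph setup, the minimum length of a walk
`W` from `s` to `t` in the complete graph `K` visiting all of `P` that
transforms `f` into `f′` is exactly `|R| + cc - 2`; in particular such a walk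
exists. -/
theorem complete_min_length {V C : Type*} [Fintype V] [DecidableEq V]
    [DecidableEq C] (f f' : V → C) (s t : V) (P : Finset V) (z : C)
    (hbal : ∀ c : C, (Finset.univ.filter (fun v => f v = c)).card
      = (Finset.univ.filter (fun v => f' v = c)).card)
    (hfs : f s = z) (hft : f' t = z)
    (hfz : ∀ v, v ≠ s → f v ≠ z) (hf'z : ∀ v, v ≠ t → f' v ≠ z) :
    let R : Finset V := Finset.univ.filter (fun v => f v ≠ f' v) ∪ {s, t} ∪ P
    let S : Finset C := R.image f
    let r : C → C → Prop := fun a b => ∃ v ∈ R, f v = a ∧ f' v = b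
    let cc : ℕ := Set.ncard
      {T : Set C | ∃ c ∈ S, T = {d | d ∈ S ∧ Relation.EqvGen r c d}}
    let isSol : List V → Prop := fun l =>
      l.Chain' (⊤ : SimpleGraph V).Adj ∧ l.head? = some s ∧
        l.getLast? = some t ∧ (∀ v ∈ P, v ∈ l) ∧ transformList l f = f'
    (∃ l : List V, isSol l ∧ l.length - 1 = R.card + cc - 2) ∧
    (∀ l : List V, isSol l → R.card + cc - 2 ≤ l.length - 1) := by
  classical
  intro R S r cc isSol
  have hs : s ∈ R := by simp [R]
  have ht : t ∈ R := by simp [R]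
  have hP : ∀ v ∈ P, v ∈ R := fun v hv => Finset.mem_union_right _ hv
  have hR : ∀ v ∉ R, f v = f' v := fun v hv => by
    by_contra h
    exact hv (by simp [R, h])
  have hcc : cc = (R.image fun v => Quot.mk r (f v)).card := by
    simp only [cc, ncard_classes, S, Finset.image_image, Function.comp_def]
  have hmem : Quot.mk r z ∈ R.image fun v => Quot.mk r (f v) :=
    Finset.mem_image.2 ⟨s, hs, by rw [hfs]⟩
  have hcard := Finset.card_erase_add_one hmem
  have hbalR : ∀ c, (R.filter fun v => f v = c).card = (R.filter fun v => f' v = c).card := by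
    intro c
    have key : ∀ g : V → C, (R.filter fun v => g v = c).card +
        (Rᶜ.filter fun v => g v = c).card = (Finset.univ.filter fun v => g v = c).card := by
      intro g
      rw [← Finset.card_union_of_disjoint (Finset.disjoint_filter_filter disjoint_compl_right),
        ← Finset.filter_union, Finset.union_compl]
    have h1 := key f
    have h2 := key f'
    have h3 := hbal c
    have h4 : (Rᶜ.filter fun v => f v = c) = Rᶜ.filter fun v => f' v = c :=
      Finset.filter_congr fun v hv => by rw [hR v (Finset.mem_compl.1 hv)]
    rw [h4] at h1
    omega
  refine ⟨?_, ?_⟩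
  · obtain ⟨l, hne, hhead, hlast, hvis, hreal, hlen⟩ := exists_walk_of_classes
      (fun w hw => exists_eulerian_class (fun _ _ => Iff.rfl) hbalR hw) hs
      (t := t) (by rwa [hfs]) ((R.image fun v => Quot.mk r (f v)).erase (Quot.mk r (f s))) subset_rfl
    rw [hfs, Finset.insert_erase hmem,
      Finset.filter_true_of_mem fun v hv => Finset.mem_image_of_mem _ hv] at hvis hreal hlen
    refine ⟨l, ⟨hne, hhead, hlast, fun v hv => hvis v (hP v hv), ?_⟩, by omega⟩
    rw [transformList_eq_comp_formPerm]
    funext v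
    by_cases hv : v ∈ R
    · exact (hreal.1 v hv).2
    · rw [Function.comp_apply, hreal.2 v hv, hR v hv]
  · rintro l ⟨-, hhead, hlast, hvis, htrans⟩
    rw [transformList_eq_comp_formPerm] at htrans
    have hRl : ∀ v ∈ R, v ∈ l := by
      intro v hv
      simp only [R, Finset.mem_union, Finset.mem_filter, Finset.mem_univ, true_and,
        Finset.mem_insert, Finset.mem_singleton] at hv
      rcases hv with (hv | rfl | rfl) | hv
      · by_contra hvl
        apply hv
        rw [← htrans, Function.comp_apply, List.formPerm_apply_of_notMem hvl]
      · exact List.mem_of_head? hhead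
      · exact List.mem_of_getLast? hlast
      · exact hvis v hv
    have hlow := card_add_card_le_length (q := Quot.mk r) hRl htrans
      (fun v hv => Quot.sound ⟨v, hv, rfl, rfl⟩) hlast
    rw [hft] at hlow
    omega
end

section
/- Let G be a connected balanced grid graph on V ⊆ ℤ² in which every vertex has degree at least 2. Let m_x = max{x : (x, y) ∈ V}, m_y = max{y : (m_x, y) ∈ V}, and v = (m_x, m_y). Let H be the grid graph on V ∪ {v + (1,1), v + (1,0), v + (2,−1), v + (1,−1)}. Then G has a Hamiltonian cycle if and only if H has a Hamiltonian path. -/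
/-- Grid adjacency on `ℤ²`: two points are adjacent iff their L¹-distance
is `1`. -/
def gridAdj (a b : ℤ × ℤ) : Prop := |a.1 - b.1| + |a.2 - b.2| = 1

instance : ∀ a b, Decidable (gridAdj a b) := fun a b => by
  unfold gridAdj; infer_instance

/-- A point `(x, y)` of `ℤ²` is even if `x + y` is even. -/
def evenPt (p : ℤ × ℤ) : Prop := (p.1 + p.2) % 2 = 0

instance : ∀ p, Decidable (evenPt p) := fun p => by
  unfold evenPt; infer_instance

/-- A finite set of grid points is balanced if it has equally many even and
odd points. -/
def BalancedPts (V : Finset (ℤ × ℤ)) : Prop :=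
  (V.filter (fun p => evenPt p)).card = (V.filter (fun p => ¬ evenPt p)).card

/-- The graph with vertex set `S` and adjacency `A` is connected: any two
vertices of `S` are joined by a walk staying inside `S`. -/
def ConnOn (S : Set (ℤ × ℤ)) (A : ℤ × ℤ → ℤ × ℤ → Prop) : Prop :=
  ∀ a ∈ S, ∀ b ∈ S, ∃ l : List (ℤ × ℤ), (∀ x ∈ l, x ∈ S) ∧ l.Chain' A ∧
    l.head? = some a ∧ l.getLast? = some b

/-- The grid graph on `S` has a Hamiltonian path. -/
def HamPathOn (S : Finset (ℤ × ℤ)) : Prop :=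
  ∃ l : List (ℤ × ℤ), l.Chain' gridAdj ∧ l.Nodup ∧ ∀ x, x ∈ l ↔ x ∈ S

/-- The grid graph on `S` has a Hamiltonian cycle. -/
def HamCycleOn (S : Finset (ℤ × ℤ)) : Prop :=
  ∃ l : List (ℤ × ℤ), l.Chain' gridAdj ∧ l.Nodup ∧ (∀ x, x ∈ l ↔ x ∈ S) ∧
    3 ≤ l.length ∧ ∃ h : l ≠ [], gridAdj (l.getLast h) (l.head h)

theorem gridAdj_iff {a b : ℤ × ℤ} : gridAdj a b ↔
    (a.1 = b.1 ∧ (a.2 = b.2 + 1 ∨ b.2 = a.2 + 1)) ∨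
      (a.2 = b.2 ∧ (a.1 = b.1 + 1 ∨ b.1 = a.1 + 1)) := by
  unfold gridAdj
  rcases abs_cases (a.1 - b.1) with h | h <;> rcases abs_cases (a.2 - b.2) with h' | h' <;> omega

theorem gridAdj_symm {a b : ℤ × ℤ} (h : gridAdj a b) : gridAdj b a := by
  rw [gridAdj_iff] at *
  omega

theorem isChain_gridAdj_reverse {l : List (ℤ × ℤ)} (h : l.IsChain gridAdj) :
    l.reverse.IsChain gridAdj :=
  List.isChain_reverse.2 (h.imp fun _ _ => gridAdj_symm)

/-- An element of a duplicate-free chain with at most one neighbour in it is an endpoint. -/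
theorem eq_cons_or_eq_append_of_unique_neighbour {l : List (ℤ × ℤ)} {a b : ℤ × ℤ}
    (hc : l.IsChain gridAdj) (hn : l.Nodup) (ha : a ∈ l)
    (hb : ∀ p ∈ l, gridAdj a p → p = b) :
    (∃ r, l = a :: r) ∨ ∃ r, l = r ++ [a] := by
  obtain ⟨s, t, rfl⟩ := List.append_of_mem ha
  rcases List.eq_nil_or_concat' s with rfl | ⟨s, p, rfl⟩
  · exact Or.inl ⟨t, rfl⟩
  rcases t with _ | ⟨q, t⟩
  · exact Or.inr ⟨_, rfl⟩
  have hp : gridAdj p a := by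
    simp [List.isChain_append, List.isChain_cons_cons] at hc
    tauto
  have hq : gridAdj a q := by
    simp [List.isChain_append, List.isChain_cons_cons] at hc
    tauto
  have h1 := hb p (by simp) (gridAdj_symm hp)
  have h2 := hb q (by simp) hq
  subst h1
  subst h2
  simp [List.nodup_append] at hn

/-- If `v` has only the neighbours `u` and `w` in `S`, then every Hamiltonian cycle of `S`
contains the edge `uv`, so opening it there gives a Hamiltonian path from `v` to `u`. -/
theorem HamCycleOn.exists_path {S : Finset (ℤ × ℤ)} {v u w : ℤ × ℤ} (h : HamCycleOn S)
    (hv : v ∈ S) (hnb : ∀ p ∈ S, gridAdj v p → p = u ∨ p = w) :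
    ∃ m, (v :: m ++ [u]).IsChain gridAdj ∧ (v :: m ++ [u]).Nodup ∧
      ∀ x, x ∈ v :: m ++ [u] ↔ x ∈ S := by
  obtain ⟨l, hc, hn, hmem, hlen, hne, hadj⟩ := h
  replace hc : l.IsChain gridAdj := hc
  obtain ⟨s, t, rfl⟩ := List.append_of_mem ((hmem v).2 hv)
  obtain ⟨k, hk, hkc, hkv⟩ : ∃ k, k = t ++ s ∧ (v :: k).IsChain gridAdj ∧
      ∀ p ∈ k.getLast?, gridAdj p v := by
    refine ⟨_, rfl, ?_, ?_⟩
    · rw [← List.cons_append, List.isChain_append]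
      rw [List.isChain_append] at hc
      refine ⟨hc.2.1, hc.1, fun p hp q hq => ?_⟩
      have e1 : (s ++ v :: t).getLast hne = p := by
        rw [List.getLast_append_of_ne_nil _ (by simp)]
        exact Option.some_injective _ ((List.getLast?_eq_some_getLast _).symm.trans hp)
      have e2 : (s ++ v :: t).head hne = q := by
        cases s <;> simp_all
      rwa [e1, e2] at hadj
    · intro p hp
      rcases List.eq_nil_or_concat' s with rfl | ⟨s, q, rfl⟩
      · rcases List.eq_nil_or_concat' t with rfl | ⟨t, q, rfl⟩
        · simp at hp
        · simp at hp
          subst hp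
          simpa using hadj
      · rw [List.isChain_append] at hc
        simp at hp
        subst hp
        exact hc.2.2 _ (by simp) _ (by simp)
  have hperm : (s ++ v :: t).Perm (v :: k) := by
    rw [hk]
    exact List.perm_middle.trans (List.Perm.cons _ List.perm_append_comm)
  have hkn := hperm.nodup_iff.1 hn
  have hkm : ∀ x, x ∈ v :: k ↔ x ∈ S := fun x => by rw [← hmem, hperm.mem_iff]
  have hkl := hperm.length_eq
  clear hk hperm
  rcases k with _ | ⟨z, k⟩
  · simp at hkl hlen
    omega
  rcases List.eq_nil_or_concat' k with rfl | ⟨k, y, rfl⟩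
  · simp at hkl hlen
    omega
  have hy : gridAdj y v := hkv y (by rw [← List.cons_append, List.getLast?_concat]; rfl)
  have hz : gridAdj v z := (List.isChain_cons_cons.1 hkc).1
  have hyz : y ≠ z := by
    rintro rfl
    simp at hkn
  have hyS := hnb y ((hkm y).1 (by simp)) (gridAdj_symm hy)
  have hzS := hnb z ((hkm z).1 (by simp)) hz
  by_cases hyu : y = u
  · subst hyu
    exact ⟨z :: k, hkc, hkn, hkm⟩
  · have hzu : z = u := by
      by_contra hzu
      exact hyz ((hyS.resolve_left hyu).trans (hzS.resolve_left hzu).symm)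
    subst hzu
    have hrev : v :: (k ++ [y]).reverse ++ [z] = ((z :: (k ++ [y])) ++ [v]).reverse := by simp
    have hperm : (v :: (k ++ [y]).reverse ++ [z]).Perm (v :: z :: (k ++ [y])) := by
      rw [hrev]
      exact (List.reverse_perm _).trans List.perm_append_comm
    refine ⟨(k ++ [y]).reverse, ?_, hperm.nodup_iff.2 hkn, fun x => by
      rw [hperm.mem_iff, hkm]⟩
    rw [hrev]
    apply isChain_gridAdj_reverse
    rw [List.isChain_append]
    refine ⟨(List.isChain_cons_cons.1 hkc).2, by simp, fun p hp q hq => ?_⟩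
    rw [← List.cons_append, List.getLast?_concat] at hp
    simp at hp hq
    subst hp hq
    exact hy

theorem hamCycleOn_iff_hamPathOn_of_corner (V : Finset (ℤ × ℤ)) (x y : ℤ)
    (hv : (x, y) ∈ V) (hu : (x, y - 1) ∈ V) (hw : (x - 1, y) ∈ V)
    (hx : ∀ p ∈ V, p.1 ≤ x) (hy : ∀ p ∈ V, p.1 = x → p.2 ≤ y) :
    HamCycleOn V ↔
      HamPathOn (V ∪ {(x + 1, y + 1), (x + 1, y), (x + 2, y - 1), (x + 1, y - 1)}) := by
  constructor
  · intro h
    obtain ⟨m, hc, hn, hm⟩ := h.exists_path (u := (x, y - 1)) (w := (x - 1, y)) hv (by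
      rintro ⟨p, q⟩ hp hadj
      have h1 := hx _ hp
      have h2 := hy _ hp
      simp only [gridAdj_iff, Prod.mk.injEq] at *
      omega)
    have hout : ∀ p ∈ (x, y) :: m ++ [(x, y - 1)], p.1 ≤ x := fun p hp => hx p ((hm p).1 hp)
    refine ⟨(x + 1, y + 1) :: (x + 1, y) ::
      (((x, y) :: m ++ [(x, y - 1)]) ++ [(x + 1, y - 1), (x + 2, y - 1)]), ?_, ?_, ?_⟩
    · have hchain : (((x, y) :: m ++ [(x, y - 1)]) ++
          [(x + 1, y - 1), (x + 2, y - 1)]).IsChain gridAdj := by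
        rw [List.isChain_append]
        refine ⟨hc, by simp [gridAdj_iff]; omega, fun p hp q hq => ?_⟩
        rw [List.getLast?_concat] at hp
        simp at hp hq
        subst hp hq
        simp [gridAdj_iff]
      refine List.isChain_cons_cons.2 ⟨by simp [gridAdj_iff], ?_⟩
      exact List.isChain_cons_cons.2 ⟨by simp [gridAdj_iff], hchain⟩
    · have hnot : ∀ i j : ℤ, x < i → (i, j) ∉ (x, y) :: m ++ [(x, y - 1)] := fun i j hi hmem =>
        absurd (hout _ hmem) (not_le.2 hi)
      generalize (x, y) :: m ++ [(x, y - 1)] = L at hn hout hnot ⊢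
      rw [List.nodup_cons, List.nodup_cons, List.nodup_append, List.mem_cons,
        List.mem_append, List.mem_append]
      refine ⟨?_, ?_, hn, by simp, fun p hp q hq hpq => ?_⟩
      · rintro (h | h | h)
        · simp at h
        · exact hnot _ _ (by omega) h
        · simp only [List.mem_cons, List.not_mem_nil, Prod.mk.injEq, or_false] at h
          omega
      · rintro (h | h)
        · exact hnot _ _ (by omega) h
        · simp only [List.mem_cons, List.not_mem_nil, Prod.mk.injEq, or_false] at h
          omega
      · subst hpq
        have := hout p hp
        simp only [List.mem_cons, List.not_mem_nil, or_false] at hq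
        rcases hq with hq | hq <;> rw [hq] at this <;> simp at this
    · intro p
      rw [List.mem_cons, List.mem_cons, List.mem_append, hm]
      simp only [List.mem_cons, List.not_mem_nil, or_false, Finset.mem_union, Finset.mem_insert,
        Finset.mem_singleton]
      tauto
  · intro h
    obtain ⟨r, hc, hn, hm⟩ : ∃ r, ((x + 1, y + 1) :: r).IsChain gridAdj ∧
        ((x + 1, y + 1) :: r).Nodup ∧ ∀ p, p ∈ (x + 1, y + 1) :: r ↔
          p ∈ V ∪ {(x + 1, y + 1), (x + 1, y), (x + 2, y - 1), (x + 1, y - 1)} := by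
      obtain ⟨l, hc, hn, hm⟩ := h
      rcases eq_cons_or_eq_append_of_unique_neighbour (a := (x + 1, y + 1)) (b := (x + 1, y))
        hc hn ((hm _).2 (by simp)) (by
          rintro ⟨p, q⟩ hp hadj
          rw [hm] at hp
          simp only [Finset.mem_union, Finset.mem_insert, Finset.mem_singleton, Prod.mk.injEq,
            gridAdj_iff] at *
          rcases hp with hp | hp
          · have h1 := hx _ hp
            have h2 := hy _ hp
            simp only at h1 h2
            omega
          · omega) with ⟨r, rfl⟩ | ⟨r, rfl⟩
      · exact ⟨r, hc, hn, hm⟩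
      · have hrev : (x + 1, y + 1) :: r.reverse = (r ++ [(x + 1, y + 1)]).reverse := by simp
        refine ⟨r.reverse, ?_, ?_, ?_⟩
        · exact hrev ▸ isChain_gridAdj_reverse hc
        · exact hrev ▸ List.nodup_reverse.2 hn
        · intro p
          rw [hrev, List.mem_reverse, hm]
    obtain ⟨m, rfl⟩ : ∃ m, r = m ++ [(x + 2, y - 1)] := by
      rcases eq_cons_or_eq_append_of_unique_neighbour (a := (x + 2, y - 1)) (b := (x + 1, y - 1))
        hc hn ((hm _).2 (by simp)) (by
          rintro ⟨p, q⟩ hp hadj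
          rw [hm] at hp
          simp only [Finset.mem_union, Finset.mem_insert, Finset.mem_singleton, Prod.mk.injEq,
            gridAdj_iff] at *
          rcases hp with hp | hp
          · have h1 := hx _ hp
            simp only at h1
            omega
          · omega) with ⟨s, hs⟩ | ⟨s, hs⟩
      · simp at hs
      · rcases s with _ | ⟨q, s⟩
        · simp at hs
        · exact ⟨s, (List.cons.inj hs).2⟩
    rw [← List.cons_append, List.isChain_append] at hc
    obtain ⟨hc, -, hlast⟩ := hc
    have hmem : ∀ p, p ∈ m → p ∈ V ∨ p = (x + 1, y) ∨ p = (x + 1, y - 1) := by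
      intro p hp
      have h1 := (hm p).1 (by simp [hp])
      have h2 : p ≠ (x + 1, y + 1) := by
        rintro rfl
        simp [hp] at hn
      have h3 : p ≠ (x + 2, y - 1) := by
        rintro rfl
        exact (List.nodup_append.1 (List.nodup_cons.1 hn).2).2.2 _ hp _ (by simp) rfl
      simp only [Finset.mem_union, Finset.mem_insert, Finset.mem_singleton] at h1
      tauto
    have hmem' : ∀ p ∈ V, p ∈ m := by
      intro p hp
      have h1 := (hm p).2 (by simp [hp])
      have h2 := hx p hp
      simp only [List.mem_cons, List.mem_append, List.not_mem_nil, or_false] at h1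
      rcases h1 with rfl | h1 | rfl
      · simp at h2
      · exact h1
      · simp at h2
    have hnm : m.Nodup := (List.nodup_append.1 (List.nodup_cons.1 hn).2).1
    clear hn hm
    rcases m with _ | ⟨b, m⟩
    · simpa using hmem' _ hv
    obtain rfl : b = (x + 1, y) := by
      have hadj := (List.isChain_cons_cons.1 hc).1
      obtain ⟨p, q⟩ := b
      rcases hmem _ List.mem_cons_self with hp | hp | hp
      · have h1 := hx _ hp
        have h2 := hy _ hp
        simp only [gridAdj_iff, Prod.mk.injEq] at *
        omega
      · exact hp
      · simp only [gridAdj_iff, Prod.mk.injEq] at *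
        omega
    have hbm := List.isChain_cons.1 (List.isChain_cons_cons.1 hc).2
    rcases List.eq_nil_or_concat' m with rfl | ⟨m, d, rfl⟩
    · simpa using hmem' _ hv
    obtain rfl : d = (x + 1, y - 1) := by
      have hadj := hlast d (by rw [← List.cons_append, ← List.cons_append, List.getLast?_concat]; rfl) _ rfl
      obtain ⟨p, q⟩ := d
      rcases hmem (p, q) (by simp) with hp | hp | hp
      · have h1 := hx _ hp
        simp only [gridAdj_iff] at *
        omega
      · simp only [gridAdj_iff, Prod.mk.injEq] at *
        omega
      · exact hp
    clear hlast
    have hmV : ∀ p, p ∈ m ↔ p ∈ V := by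
      intro p
      constructor
      · intro hp
        rcases hmem p (by simp [hp]) with h | rfl | rfl
        · exact h
        · simp [hp] at hnm
        · exact ((List.nodup_append.1 (List.nodup_cons.1 hnm).2).2.2 _ hp _ (by simp) rfl).elim
      · intro hp
        have h1 := hmem' p hp
        have h2 := hx p hp
        simp only [List.mem_cons, List.mem_append, List.not_mem_nil, or_false] at h1
        rcases h1 with rfl | h1 | rfl
        · simp at h2
        · exact h1
        · simp at h2
    replace hnm : m.Nodup := (List.nodup_append.1 (List.nodup_cons.1 hnm).2).1
    have hfirst : ∀ p ∈ m.head?, p = (x, y) := by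
      rintro ⟨p, q⟩ hp
      have hpV := (hmV _).1 (List.mem_of_mem_head? hp)
      have hadj : gridAdj (x + 1, y) (p, q) := hbm.1 (p, q) (by cases m <;> simp_all)
      have h1 := hx _ hpV
      simp only [gridAdj_iff, Prod.mk.injEq] at *
      omega
    have hlast : ∀ p ∈ m.getLast?, p = (x, y - 1) := by
      rintro ⟨p, q⟩ hp
      have hpV := (hmV _).1 (List.mem_of_mem_getLast? hp)
      have hadj : gridAdj (p, q) (x + 1, y - 1) :=
        (List.isChain_append.1 hbm.2).2.2 _ hp _ rfl
      have h1 := hx _ hpV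
      simp only [gridAdj_iff, Prod.mk.injEq] at *
      omega
    have hne : m ≠ [] := List.ne_nil_of_mem ((hmV _).2 hv)
    refine ⟨m, (List.isChain_append.1 hbm.2).1, hnm, hmV, ?_, hne, ?_⟩
    · have hsub : [(x, y), (x, y - 1), (x - 1, y)] ⊆ m := by
        simp [hmV, hv, hu, hw]
      exact (List.subperm_of_subset (by simp; omega) hsub).length_le
    · rw [hlast _ (List.getLast?_eq_some_getLast hne), hfirst _ (List.head?_eq_some_head hne)]
      simp [gridAdj_iff]

/-- let `G` be a connected balanced grid graph on `V ⊆ ℤ²` with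
all degrees at least `2`, let `v = (m_x, m_y)` be the top vertex of the
rightmost column, and let `H` be the grid graph on
`V ∪ {v+(1,1), v+(1,0), v+(2,-1), v+(1,-1)}`. Then `G` has a Hamiltonian
cycle iff `H` has a Hamiltonian path. -/
theorem ham_cycle_iff_ham_path (V : Finset (ℤ × ℤ)) (hne : V.Nonempty)
    (hconn : ConnOn (↑V) gridAdj) (hbal : BalancedPts V)
    (hdeg : ∀ a ∈ V, 2 ≤ (V.filter (fun b => gridAdj a b)).card) :
    let mx : ℤ := (V.image Prod.fst).max' (hne.image _)
    let my : ℤ := ((V.filter (fun p => p.1 = mx)).image Prod.snd).max' (by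
      obtain ⟨p, hp, hpx⟩ :=
        Finset.mem_image.mp ((V.image Prod.fst).max'_mem (hne.image _))
      exact ⟨p.2, Finset.mem_image.mpr ⟨p, Finset.mem_filter.mpr ⟨hp, hpx⟩, rfl⟩⟩)
    HamCycleOn V ↔
      HamPathOn (V ∪ {(mx + 1, my + 1), (mx + 1, my), (mx + 2, my - 1),
        (mx + 1, my - 1)}) := by
  intro mx my
  have hx : ∀ p ∈ V, p.1 ≤ mx := fun p hp =>
    Finset.le_max' _ _ (Finset.mem_image_of_mem _ hp)
  have hy : ∀ p ∈ V, p.1 = mx → p.2 ≤ my := fun p hp hpx =>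
    Finset.le_max' _ _ (Finset.mem_image_of_mem _ (Finset.mem_filter.2 ⟨hp, hpx⟩))
  have hv : (mx, my) ∈ V := by
    obtain ⟨p, hp, hpy⟩ := Finset.mem_image.1 (show my ∈ _ from Finset.max'_mem _ _)
    obtain ⟨hpV, hpx⟩ := Finset.mem_filter.1 hp
    rwa [← hpx, ← hpy]
  clear_value mx my
  have hsub : V.filter (fun b => gridAdj (mx, my) b) ⊆ {(mx, my - 1), (mx - 1, my)} := by
    rintro ⟨p, q⟩ hp
    obtain ⟨hpV, hadj⟩ := Finset.mem_filter.1 hp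
    have h1 := hx _ hpV
    have h2 := hy _ hpV
    simp only [gridAdj_iff, Finset.mem_insert, Finset.mem_singleton, Prod.mk.injEq] at *
    omega
  have heq := Finset.eq_of_subset_of_card_le hsub (Finset.card_le_two.trans (hdeg _ hv))
  have hmem : ∀ p ∈ ({(mx, my - 1), (mx - 1, my)} : Finset (ℤ × ℤ)), p ∈ V := fun p hp =>
    (Finset.mem_filter.1 (heq ▸ hp)).1
  exact hamCycleOn_iff_hamPathOn_of_corner V mx my hv (hmem _ (by simp)) (hmem _ (by simp)) hx hy
end

section
/- Let G be a connected balanced grid graph on a finite set V ⊆ ℤ², and let B be the bounding box of V. Let H be the grid graph on B. Define colorings f, f′ of H by: f(x, y) = 1 if x + y is odd and f(x, y) = 2 if x + y is even; f′(v) = 3 − f(v) for v ∈ V and f′(v) = f(v) for v ∈ B ∖ V. Then G has a Hamiltonian path if and only if there is a walk in H of length at most |V| − 1 that transforms f into f′. -/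
/-- King adjacency on `ℤ²`: two distinct points are adjacent iff their
L∞-distance is `1`. -/
def kingAdj (a b : ℤ × ℤ) : Prop :=
  a ≠ b ∧ max |a.1 - b.1| |a.2 - b.2| = 1

theorem transformList_apply_of_notMem {V C : Type*} [DecidableEq V] (m : List V) (f : V → C)
    (v : V) (hv : v ∉ m) : transformList m f v = f v := by
  induction m generalizing f with
  | nil => rfl
  | cons a l ih =>
    cases l with
    | nil => rfl
    | cons b l =>
      have hva : v ≠ a := fun h => hv (by simp [h])
      have hvb : v ≠ b := fun h => hv (by simp [h])
      rw [transformList, ih _ (fun h => hv (List.mem_cons_of_mem _ h))]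
      simp [swapC, hva, hvb]

theorem evenPt_iff_not_of_gridAdj {a b : ℤ × ℤ} (h : gridAdj a b) : evenPt a ↔ ¬ evenPt b := by
  unfold gridAdj at h
  unfold evenPt
  grind

/-- Moving a token along a simple path in a properly `{1, 2}`-colored graph flips every color on
the path, provided that the token has the color opposite to that of the final vertex. The latter
condition is expressed through the parity of the length. -/
theorem transformList_flip {V : Type*} [DecidableEq V] {A : V → V → Prop} {f : V → ℕ}
    (hf : ∀ v, f v ≤ 3) (hA : ∀ a b, A a b → f b = 3 - f a) (l : List V) (a : V) (g : V → ℕ)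
    (hchain : (a :: l).IsChain A) (hnd : (a :: l).Nodup) (hg : ∀ v ∈ l, g v = f v)
    (ha : g a = if Even l.length then 3 - f a else f a) (v : V) :
    transformList (a :: l) g v = if v ∈ a :: l then 3 - f v else g v := by
  induction l generalizing a g with
  | nil =>
    by_cases hv : v = a
    · subst hv
      simpa [transformList] using ha
    · simp [transformList, hv]
  | cons b l ih =>
    rw [List.isChain_cons_cons] at hchain
    have hab := hA a b hchain.1
    have hfa := hf a
    have hnd' := List.nodup_cons.1 hnd
    have hbl := (List.nodup_cons.1 hnd'.2).1
    have hne : b ≠ a := fun h => hnd'.1 (by simp [h])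
    have hgb : g b = f b := hg b (by simp)
    rw [transformList, ih b (swapC g a b) hchain.2 hnd'.2]
    · by_cases hva : v = a
      · subst hva
        rw [if_neg hnd'.1]
        simp [swapC, hgb, hab]
      · by_cases hvb : v = b
        · simp [hvb]
        · simp [hva, hvb, swapC]
    · intro w hw
      have hwa : w ≠ a := fun h => hnd'.1 (by simp [← h, hw])
      have hwb : w ≠ b := fun h => hbl (h ▸ hw)
      simp [swapC, hwa, hwb, hg w (List.mem_cons_of_mem _ hw)]
    · have hs : swapC g a b b = g a := by simp [swapC, hne]
      rw [hs, ha, List.length_cons]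
      by_cases h : Even l.length
      · rw [if_neg (by simpa [Nat.even_add_one] using h), if_pos h]
        omega
      · rw [if_pos (by simpa [Nat.even_add_one] using h), if_neg h]
        omega

theorem BalancedPts.even_card {V : Finset (ℤ × ℤ)} (h : BalancedPts V) : Even V.card := by
  have := V.card_filter_add_card_filter_not (fun p => evenPt p)
  unfold BalancedPts at h
  exact ⟨_, by rw [← this, ← h]⟩

/-- let `G` be a connected balanced grid graph on a finite
`V ⊆ ℤ²`, `B` the bounding box of `V`, and `H` the grid graph on `B`.
With `f` coloring odd points `1` and even points `2`, and `f'` flipping `f`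
exactly on `V`, the graph `G` has a Hamiltonian path iff there is a walk in
`H` of length at most `|V| - 1` transforming `f` into `f'`. -/
theorem ham_path_iff_swap_walk_grid (V : Finset (ℤ × ℤ)) (hne : V.Nonempty)
    (hconn : ConnOn (↑V) gridAdj) (hbal : BalancedPts V) :
    let B : Finset (ℤ × ℤ) :=
      (Finset.Icc ((V.image Prod.fst).min' (hne.image _))
          ((V.image Prod.fst).max' (hne.image _))) ×ˢ
        (Finset.Icc ((V.image Prod.snd).min' (hne.image _))
          ((V.image Prod.snd).max' (hne.image _)))
    let f : ℤ × ℤ → ℕ := fun p => if evenPt p then 2 else 1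
    let f' : ℤ × ℤ → ℕ := fun p => if p ∈ V then 3 - f p else f p
    HamPathOn V ↔
      ∃ m : List (ℤ × ℤ), (∀ x ∈ m, x ∈ B) ∧ m.Chain' gridAdj ∧ m ≠ [] ∧
        transformList m f = f' ∧ m.length - 1 ≤ V.card - 1 := by
  intro B f f'
  have hf : ∀ v, f v = 1 ∨ f v = 2 := fun v => by
    by_cases h : evenPt v <;> simp [f, h]
  constructor
  · rintro ⟨l, hchain, hnd, hmem⟩
    have hlV : l.toFinset = V := by ext x; simp [hmem]
    have hcard : l.length = V.card := by rw [← hlV, List.toFinset_card_of_nodup hnd]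
    refine ⟨l, fun x hx => ?_, hchain, ?_, ?_, by rw [hcard]⟩
    · have hxV := (hmem x).1 hx
      have h₁ := Finset.mem_image_of_mem Prod.fst hxV
      have h₂ := Finset.mem_image_of_mem Prod.snd hxV
      simp only [B, Finset.mem_product, Finset.mem_Icc]
      exact ⟨⟨Finset.min'_le _ _ h₁, Finset.le_max' _ _ h₁⟩,
        ⟨Finset.min'_le _ _ h₂, Finset.le_max' _ _ h₂⟩⟩
    · obtain ⟨x, hx⟩ := hne
      exact List.ne_nil_of_mem ((hmem x).2 hx)
    · cases l with
      | nil =>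
        obtain ⟨x, hx⟩ := hne
        simpa using (hmem x).2 hx
      | cons a l =>
        have heven := hbal.even_card
        rw [← hcard, List.length_cons, Nat.even_add_one] at heven
        funext v
        rw [transformList_flip (A := gridAdj) (f := f) (fun v => by have := hf v; omega) ?_ l a f
          hchain hnd (fun _ _ => rfl) (by rw [if_neg heven])]
        · simp only [hmem, f']
        · intro a b hab
          have := evenPt_iff_not_of_gridAdj hab
          by_cases hb : evenPt b <;> simp [f, this, hb]
  · rintro ⟨m, -, hchain, -, htr, hlen⟩
    have hpos := hne.card_pos
    have hsub : V ⊆ m.toFinset := by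
      intro v hv
      by_contra hvm
      have h := transformList_apply_of_notMem m f v (by simpa using hvm)
      rw [htr] at h
      simp only [f', if_pos hv] at h
      have := hf v
      omega
    have h₁ := Finset.card_le_card hsub
    have h₂ := m.toFinset_card_le
    have heq := Finset.eq_of_subset_of_card_le hsub (by omega)
    refine ⟨m, hchain, ?_, fun x => by rw [heq, List.mem_toFinset]⟩
    exact Multiset.toFinset_card_eq_card_iff_nodup.1 (show m.toFinset.card = m.length by omega)
end
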